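/- Fix an integer n ≥ 1 and a constant K > 0. There exists a constant C ≥ 1 depending only on n and K such that the following holds: for every nonempty bounded open set U ⊆ ℝⁿ, every principal Dirichlet eigenfunction φ of U, and every Euclidean ball B(z,r) contained in U with λ(U)·r² ≤ K, one has φ(x) ≤ C·φ(y) for all x, y ∈ B(z, r/2). -/

import Mathlib

open Real MeasureTheory

noncomputable def dirichletEigenvalue (n : ℕ) (U : Set (EuclideanSpace ℝ (Fin n))) : ℝ :=
  sInf {R : ℝ | ∃ f : EuclideanSpace ℝ (Fin n) → ℝ,
    ContDiff ℝ (⊤ : ℕ∞) f ∧ HasCompactSupport f ∧ tsupport f ⊆ U ∧ f ≠ 0 ∧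
    R = (∫ x, ‖fderiv ℝ f x‖ ^ 2) / (∫ x, (f x) ^ 2)}

/-- The Laplacian as the sum of the unmixed second partial derivatives. -/
noncomputable def laplacian {n : ℕ} (φ : EuclideanSpace ℝ (Fin n) → ℝ)
    (x : EuclideanSpace ℝ (Fin n)) : ℝ :=
  ∑ i : Fin n, fderiv ℝ (fun y => fderiv ℝ φ y (EuclideanSpace.single i 1)) x
    (EuclideanSpace.single i 1)

/-- `φ` is a principal Dirichlet eigenfunction of the nonempty bounded open set `U`:
continuous on the closure of `U`, smooth and positive on `U`, vanishing on the boundary,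
satisfying `Δφ = -λ(U)·φ` on `U`, and normalized in `L²(U)`. -/
structure IsPrincipalDirichletEigenfunction {n : ℕ} (U : Set (EuclideanSpace ℝ (Fin n)))
    (φ : EuclideanSpace ℝ (Fin n) → ℝ) : Prop where
  continuousOn : ContinuousOn φ (closure U)
  smooth : ContDiffOn ℝ (⊤ : ℕ∞) φ U
  pos : ∀ x ∈ U, 0 < φ x
  vanishes : ∀ x ∈ frontier U, φ x = 0
  eigenEq : ∀ x ∈ U, laplacian φ x = -(dirichletEigenvalue n U) * φ x
  normalized : (∫ x in U, (φ x) ^ 2) = 1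

open Filter Topology in
/-- A function with a local maximum at `t` has nonpositive second derivative there. -/
theorem IsLocalMax.deriv_deriv_nonpos {f : ℝ → ℝ} {t : ℝ} (h : IsLocalMax f t)
    (hc : ContinuousAt f t) : deriv (deriv f) t ≤ 0 := by
  by_contra! hpos
  have hmin := isLocalMin_of_deriv_deriv_pos hpos h.deriv_eq_zero hc
  have heq : f =ᶠ[𝓝 t] fun _ => f t := by
    filter_upwards [h, hmin] with s h1 h2 using le_antisymm h1 h2
  have h2 := heq.deriv.deriv_eq
  simp at h2
  linarith

/-- The partial derivative of `f` in the direction of the `i`-th coordinate. -/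
noncomputable def partialDeriv {n : ℕ} (i : Fin n) (f : EuclideanSpace ℝ (Fin n) → ℝ)
    (x : EuclideanSpace ℝ (Fin n)) : ℝ :=
  fderiv ℝ f x (EuclideanSpace.single i 1)

section PartialDeriv

variable {n : ℕ} {U : Set (EuclideanSpace ℝ (Fin n))} {f g : EuclideanSpace ℝ (Fin n) → ℝ}
  {x : EuclideanSpace ℝ (Fin n)}

theorem laplacian_eq_sum_partialDeriv (f : EuclideanSpace ℝ (Fin n) → ℝ)
    (x : EuclideanSpace ℝ (Fin n)) :
    laplacian f x = ∑ i, partialDeriv i (partialDeriv i f) x := rfl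

theorem ContDiffOn.partialDeriv (hf : ContDiffOn ℝ (⊤ : ℕ∞) f U) (hU : IsOpen U) (i : Fin n) :
    ContDiffOn ℝ (⊤ : ℕ∞) (partialDeriv i f) U :=
  (hf.fderiv_of_isOpen hU (by simp)).clm_apply contDiffOn_const

theorem ContDiffOn.differentiableAt_of_isOpen (hf : ContDiffOn ℝ (⊤ : ℕ∞) f U) (hU : IsOpen U)
    (hx : x ∈ U) : DifferentiableAt ℝ f x :=
  (hf.contDiffAt (hU.mem_nhds hx)).differentiableAt (by simp)

theorem partialDeriv_congr (hU : IsOpen U) (h : Set.EqOn f g U) (i : Fin n) :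
    Set.EqOn (partialDeriv i f) (partialDeriv i g) U := fun x hx => by
  have : f =ᶠ[nhds x] g := Filter.eventuallyEq_of_mem (hU.mem_nhds hx) h
  simp only [partialDeriv, this.fderiv_eq]

theorem partialDeriv_mul (hf : DifferentiableAt ℝ f x) (hg : DifferentiableAt ℝ g x) (i : Fin n) :
    partialDeriv i (fun y => f y * g y) x
      = partialDeriv i f x * g x + f x * partialDeriv i g x := by
  simp only [partialDeriv, fderiv_fun_mul hf hg]
  simp
  ring

theorem partialDeriv_add (hf : DifferentiableAt ℝ f x) (hg : DifferentiableAt ℝ g x) (i : Fin n) :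
    partialDeriv i (fun y => f y + g y) x = partialDeriv i f x + partialDeriv i g x := by
  simp only [partialDeriv, fderiv_fun_add hf hg]
  simp

theorem partialDeriv_sum {ι : Type*} {s : Finset ι} {F : ι → EuclideanSpace ℝ (Fin n) → ℝ}
    (hF : ∀ k ∈ s, DifferentiableAt ℝ (F k) x) (i : Fin n) :
    partialDeriv i (fun y => ∑ k ∈ s, F k y) x = ∑ k ∈ s, partialDeriv i (F k) x := by
  simp only [partialDeriv, fderiv_fun_sum hF]
  simp

theorem partialDeriv_const_sub (c : ℝ) (i : Fin n) :
    partialDeriv i (fun y => c - f y) x = -partialDeriv i f x := by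
  simp [partialDeriv, fderiv_const_sub]

theorem partialDeriv_comm (hf : ContDiffOn ℝ (⊤ : ℕ∞) f U) (hU : IsOpen U) (hx : x ∈ U)
    (i j : Fin n) :
    partialDeriv i (partialDeriv j f) x = partialDeriv j (partialDeriv i f) x := by
  have hd : DifferentiableAt ℝ (fderiv ℝ f) x :=
    ((hf.fderiv_of_isOpen hU (m := (⊤ : ℕ∞)) (by simp)).contDiffAt
      (hU.mem_nhds hx)).differentiableAt (by simp)
  have key (k l : Fin n) : partialDeriv k (partialDeriv l f) x
      = fderiv ℝ (fderiv ℝ f) x (EuclideanSpace.single k 1) (EuclideanSpace.single l 1) := by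
    change fderiv ℝ (fun y => fderiv ℝ f y (EuclideanSpace.single l 1)) x _ = _
    rw [fderiv_clm_apply hd (by fun_prop)]
    simp
  rw [key, key]
  exact (hf.contDiffAt (hU.mem_nhds hx)).isSymmSndFDerivAt (by
    simpa using WithTop.coe_le_coe.2 (le_top : (2 : ℕ∞) ≤ ⊤)) _ _

theorem partialDeriv_eq_zero_of_isLocalMax (h : IsLocalMax f x) (i : Fin n) :
    partialDeriv i f x = 0 := by
  simp [partialDeriv, h.fderiv_eq_zero]

theorem partialDeriv_partialDeriv_nonpos_of_isLocalMax (h : IsLocalMax f x)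
    (hf : ContDiffOn ℝ (⊤ : ℕ∞) f U) (hU : IsOpen U) (hx : x ∈ U) (i : Fin n) :
    partialDeriv i (partialDeriv i f) x ≤ 0 := by
  set γ : ℝ → EuclideanSpace ℝ (Fin n) := fun t => x + t • EuclideanSpace.single i 1 with hγ
  have hγ0 : γ 0 = x := by simp [hγ]
  have hγc : Continuous γ := by fun_prop
  have hγd (t : ℝ) : HasDerivAt γ (EuclideanSpace.single i 1) t := by
    have := ((hasDerivAt_id t).smul_const (EuclideanSpace.single i (1 : ℝ))).const_add x
    rwa [one_smul] at this
  have hder {g : EuclideanSpace ℝ (Fin n) → ℝ} (hg : ContDiffOn ℝ (⊤ : ℕ∞) g U) {t : ℝ}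
      (ht : γ t ∈ U) : deriv (g ∘ γ) t = partialDeriv i g (γ t) :=
    ((hg.differentiableAt_of_isOpen hU ht).hasFDerivAt.comp_hasDerivAt t (hγd t)).deriv
  have hmem : γ ⁻¹' U ∈ nhds (0 : ℝ) := (hU.preimage hγc).mem_nhds (by simpa [hγ0] using hx)
  have hev : deriv (f ∘ γ) =ᶠ[nhds 0] partialDeriv i f ∘ γ := by
    filter_upwards [hmem] with t ht using hder hf ht
  have hmax : IsLocalMax (f ∘ γ) 0 := by
    have ht : Filter.Tendsto γ (nhds 0) (nhds x) := hγ0 ▸ hγc.tendsto 0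
    filter_upwards [ht.eventually h] with t ht
    simpa [hγ0] using ht
  have hcont : ContinuousAt (f ∘ γ) 0 :=
    ContinuousAt.comp (by rw [hγ0]; exact (hf.differentiableAt_of_isOpen hU hx).continuousAt)
      hγc.continuousAt
  have := hmax.deriv_deriv_nonpos hcont
  rwa [hev.deriv_eq, hder (hf.partialDeriv hU i) (by rwa [hγ0]), hγ0] at this

theorem norm_fderiv_le_sqrt_sum_partialDeriv_sq :
    ‖fderiv ℝ f x‖ ≤ √(∑ i, partialDeriv i f x ^ 2) := by
  refine ContinuousLinearMap.opNorm_le_bound _ (Real.sqrt_nonneg _) fun v => ?_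
  have hv : fderiv ℝ f x v = ∑ i, partialDeriv i f x * v i := by
    conv_lhs => rw [← (EuclideanSpace.basisFun (Fin n) ℝ).sum_repr v]
    simp [partialDeriv, mul_comm]
  rw [hv, EuclideanSpace.norm_eq, ← Real.sqrt_mul (by positivity)]
  refine Real.abs_le_sqrt ?_
  simpa using Finset.sum_mul_sq_le_sq_mul_sq Finset.univ (fun i => partialDeriv i f x) v

end PartialDeriv

section Harnack

variable {n : ℕ} {U : Set (EuclideanSpace ℝ (Fin n))}

/-- The squared norm of the gradient. -/
noncomputable def gradSq (u : EuclideanSpace ℝ (Fin n) → ℝ) (x : EuclideanSpace ℝ (Fin n)) : ℝ :=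
  ∑ i, partialDeriv i u x * partialDeriv i u x

theorem gradSq_nonneg (u : EuclideanSpace ℝ (Fin n) → ℝ) (x : EuclideanSpace ℝ (Fin n)) :
    0 ≤ gradSq u x :=
  Finset.sum_nonneg fun _ _ => mul_self_nonneg _

theorem ContDiffOn.gradSq {u : EuclideanSpace ℝ (Fin n) → ℝ} (hu : ContDiffOn ℝ (⊤ : ℕ∞) u U)
    (hU : IsOpen U) : ContDiffOn ℝ (⊤ : ℕ∞) (gradSq u) U :=
  ContDiffOn.sum fun i _ => (hu.partialDeriv hU i).mul (hu.partialDeriv hU i)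

theorem partialDeriv_gradSq {u : EuclideanSpace ℝ (Fin n) → ℝ} (hu : ContDiffOn ℝ (⊤ : ℕ∞) u U)
    (hU : IsOpen U) {x : EuclideanSpace ℝ (Fin n)} (hx : x ∈ U) (j : Fin n) :
    partialDeriv j (gradSq u) x
      = 2 * ∑ i, partialDeriv i u x * partialDeriv j (partialDeriv i u) x := by
  have hd (i : Fin n) := (hu.partialDeriv hU i).differentiableAt_of_isOpen hU hx
  change partialDeriv j (fun y => ∑ i, partialDeriv i u y * partialDeriv i u y) x = _
  rw [partialDeriv_sum fun i _ => (hd i).fun_mul (hd i), Finset.mul_sum]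
  refine Finset.sum_congr rfl fun i _ => ?_
  rw [partialDeriv_mul (hd i) (hd i)]
  ring

/-- Bochner's formula. -/
theorem laplacian_gradSq {u : EuclideanSpace ℝ (Fin n) → ℝ} (hu : ContDiffOn ℝ (⊤ : ℕ∞) u U)
    (hU : IsOpen U) {x : EuclideanSpace ℝ (Fin n)} (hx : x ∈ U) :
    laplacian (gradSq u) x = 2 * ∑ j, ∑ i, partialDeriv j (partialDeriv i u) x ^ 2
      + 2 * ∑ i, partialDeriv i u x * partialDeriv i (laplacian u) x := by
  have h1 (i : Fin n) := hu.partialDeriv hU i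
  have h2 (i j : Fin n) := (h1 i).partialDeriv hU j
  have hd1 (i : Fin n) := (h1 i).differentiableAt_of_isOpen hU hx
  have hd2 (i j : Fin n) := (h2 i j).differentiableAt_of_isOpen hU hx
  have hcomm (i j : Fin n) : partialDeriv j (partialDeriv j (partialDeriv i u)) x
      = partialDeriv i (partialDeriv j (partialDeriv j u)) x := by
    rw [partialDeriv_congr hU (fun y hy => partialDeriv_comm hu hU hy j i) j hx]
    exact partialDeriv_comm (h1 j) hU hx j i
  have hsnd (j : Fin n) : partialDeriv j (partialDeriv j (gradSq u)) x
      = 2 * ∑ i, partialDeriv j (partialDeriv i u) x ^ 2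
        + 2 * ∑ i, partialDeriv i u x * partialDeriv i (partialDeriv j (partialDeriv j u)) x := by
    rw [partialDeriv_congr hU (g := fun y => ∑ i, (2 * partialDeriv i u y) *
      partialDeriv j (partialDeriv i u) y) (fun y hy => by
        rw [partialDeriv_gradSq hu hU hy, Finset.mul_sum]
        exact Finset.sum_congr rfl fun i _ => by ring) j hx,
      partialDeriv_sum fun i _ => ((hd1 i).const_mul 2).fun_mul (hd2 i j), Finset.mul_sum,
      Finset.mul_sum, ← Finset.sum_add_distrib]
    refine Finset.sum_congr rfl fun i _ => ?_
    rw [partialDeriv_mul ((hd1 i).const_mul 2) (hd2 i j),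
      partialDeriv_mul (differentiableAt_const 2) (hd1 i), hcomm]
    simp [partialDeriv]
    ring
  have hlap (i : Fin n) : partialDeriv i (laplacian u) x
      = ∑ j, partialDeriv i (partialDeriv j (partialDeriv j u)) x :=
    partialDeriv_sum (fun j _ => hd2 j j) i
  simp only [laplacian_eq_sum_partialDeriv (gradSq u), hsnd, hlap, Finset.sum_add_distrib,
    Finset.mul_sum]
  congr 1
  exact Finset.sum_comm

theorem le_laplacian_gradSq {u : EuclideanSpace ℝ (Fin n) → ℝ} (hn : 1 ≤ n)
    (hu : ContDiffOn ℝ (⊤ : ℕ∞) u U) (hU : IsOpen U) {c : ℝ} (hc : 0 ≤ c)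
    (heq : ∀ x ∈ U, laplacian u x = -c - gradSq u x)
    {x : EuclideanSpace ℝ (Fin n)} (hx : x ∈ U) :
    2 * gradSq u x ^ 2 / n - 2 * ∑ i, partialDeriv i u x * partialDeriv i (gradSq u) x
      ≤ laplacian (gradSq u) x := by
  have hn0 : (0 : ℝ) < n := by exact_mod_cast hn
  have hgrad (i : Fin n) : partialDeriv i (laplacian u) x = -partialDeriv i (gradSq u) x := by
    rw [partialDeriv_congr hU heq i hx, partialDeriv_const_sub]
  have hdiag : ∑ j, partialDeriv j (partialDeriv j u) x ^ 2
      ≤ ∑ j, ∑ i, partialDeriv j (partialDeriv i u) x ^ 2 :=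
    Finset.sum_le_sum fun j _ => Finset.single_le_sum
      (f := fun i => partialDeriv j (partialDeriv i u) x ^ 2)
      (fun i _ => sq_nonneg _) (Finset.mem_univ j)
  have hcs : laplacian u x ^ 2 ≤ n * ∑ j, partialDeriv j (partialDeriv j u) x ^ 2 := by
    simpa [laplacian_eq_sum_partialDeriv] using sq_sum_le_card_mul_sum_sq (s := Finset.univ)
      (f := fun j => partialDeriv j (partialDeriv j u) x)
  have hw := gradSq_nonneg u x
  have hsq : gradSq u x ^ 2 / n ≤ ∑ j, partialDeriv j (partialDeriv j u) x ^ 2 := by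
    rw [div_le_iff₀' hn0]
    refine le_trans ?_ hcs
    rw [heq x hx]
    nlinarith [mul_nonneg hc hw]
  rw [laplacian_gradSq hu hU hx]
  simp only [hgrad, mul_neg, Finset.sum_neg_distrib]
  rw [mul_div_assoc]
  linarith

theorem contDiff_const_sub_norm_sq (ρ : ℝ) (z : EuclideanSpace ℝ (Fin n)) :
    ContDiff ℝ (⊤ : ℕ∞) fun y => ρ ^ 2 - ‖y - z‖ ^ 2 :=
  contDiff_const.sub ((contDiff_id.sub contDiff_const).norm_sq ℝ)

theorem partialDeriv_const_sub_norm_sq (ρ : ℝ) (z x : EuclideanSpace ℝ (Fin n)) (i : Fin n) :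
    partialDeriv i (fun y => ρ ^ 2 - ‖y - z‖ ^ 2) x = -2 * (x i - z i) := by
  have hd : HasFDerivAt (fun y => ‖y - z‖ ^ 2) _ x := ((hasFDerivAt_id x).sub_const z).norm_sq
  rw [partialDeriv_const_sub, partialDeriv, hd.fderiv]
  simp [EuclideanSpace.inner_single_right]

theorem partialDeriv_partialDeriv_const_sub_norm_sq (ρ : ℝ) (z x : EuclideanSpace ℝ (Fin n))
    (i : Fin n) :
    partialDeriv i (partialDeriv i fun y => ρ ^ 2 - ‖y - z‖ ^ 2) x = -2 := by
  have : (partialDeriv i fun y => ρ ^ 2 - ‖y - z‖ ^ 2) = fun y => -2 * (y i - z i) :=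
    funext fun y => partialDeriv_const_sub_norm_sq ρ z y i
  have hd : HasFDerivAt (fun y : EuclideanSpace ℝ (Fin n) => -2 * (y i - z i))
      ((-2 : ℝ) • (EuclideanSpace.proj i : EuclideanSpace ℝ (Fin n) →L[ℝ] ℝ)) x :=
    (((EuclideanSpace.proj i : EuclideanSpace ℝ (Fin n) →L[ℝ] ℝ).hasFDerivAt).sub_const
      (z i)).const_mul (-2)
  rw [this, partialDeriv, hd.fderiv]
  simp

theorem partialDeriv_partialDeriv_sq_mul {η w : EuclideanSpace ℝ (Fin n) → ℝ} (hU : IsOpen U)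
    (hη : ContDiffOn ℝ (⊤ : ℕ∞) η U) (hw : ContDiffOn ℝ (⊤ : ℕ∞) w U)
    {x : EuclideanSpace ℝ (Fin n)} (hx : x ∈ U) (i : Fin n) :
    partialDeriv i (fun y => η y * η y * w y) x
        = 2 * η x * partialDeriv i η x * w x + η x ^ 2 * partialDeriv i w x ∧
      partialDeriv i (partialDeriv i fun y => η y * η y * w y) x
        = 2 * partialDeriv i η x ^ 2 * w x + 2 * η x * partialDeriv i (partialDeriv i η) x * w x
          + 4 * η x * partialDeriv i η x * partialDeriv i w x
          + η x ^ 2 * partialDeriv i (partialDeriv i w) x := by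
  have hfst {y} (hy : y ∈ U) : partialDeriv i (fun y => η y * η y * w y) y
      = (partialDeriv i η y * η y + η y * partialDeriv i η y) * w y
        + η y * η y * partialDeriv i w y := by
    have dη := hη.differentiableAt_of_isOpen hU hy
    have dw := hw.differentiableAt_of_isOpen hU hy
    rw [partialDeriv_mul (f := fun y => η y * η y) (dη.mul dη) dw, partialDeriv_mul dη dη]
  refine ⟨by rw [hfst hx]; ring, ?_⟩
  have dη := hη.differentiableAt_of_isOpen hU hx
  have dw := hw.differentiableAt_of_isOpen hU hx
  have dη' := (hη.partialDeriv hU i).differentiableAt_of_isOpen hU hx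
  have dw' := (hw.partialDeriv hU i).differentiableAt_of_isOpen hU hx
  rw [partialDeriv_congr hU (fun y hy => hfst hy) i hx,
    partialDeriv_add (((dη'.fun_mul dη).fun_add (dη.fun_mul dη')).fun_mul dw)
      ((dη.fun_mul dη).fun_mul dw'),
    partialDeriv_mul ((dη'.fun_mul dη).fun_add (dη.fun_mul dη')) dw,
    partialDeriv_add (dη'.fun_mul dη) (dη.fun_mul dη'), partialDeriv_mul dη' dη, partialDeriv_mul dη dη',
    partialDeriv_mul (f := fun y => η y * η y) (dη.mul dη) dw', partialDeriv_mul dη dη]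
  ring

theorem cutoff_sq_mul_gradSq_le_of_isLocalMax {u : EuclideanSpace ℝ (Fin n) → ℝ} (hn : 1 ≤ n)
    (hu : ContDiffOn ℝ (⊤ : ℕ∞) u U) (hU : IsOpen U) {c : ℝ} (hc : 0 ≤ c)
    (heq : ∀ x ∈ U, laplacian u x = -c - gradSq u x) {z x : EuclideanSpace ℝ (Fin n)}
    (hx : x ∈ U) {ρ : ℝ} (hρ : 0 < ρ) (hxρ : ‖x - z‖ < ρ)
    (hmax : IsLocalMax (fun y => (ρ ^ 2 - ‖y - z‖ ^ 2) * (ρ ^ 2 - ‖y - z‖ ^ 2) * gradSq u y) x) :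
    (ρ ^ 2 - ‖x - z‖ ^ 2) * (ρ ^ 2 - ‖x - z‖ ^ 2) * gradSq u x ≤ (10 * n * ρ) ^ 2 := by
  have hn1 : (1 : ℝ) ≤ n := by exact_mod_cast hn
  have hn0 : (0 : ℝ) < n := by linarith
  set η : EuclideanSpace ℝ (Fin n) → ℝ := fun y => ρ ^ 2 - ‖y - z‖ ^ 2 with hηdef
  have hη : ContDiffOn ℝ (⊤ : ℕ∞) η U := (contDiff_const_sub_norm_sq ρ z).contDiffOn
  have hw := hu.gradSq hU
  have hG : ContDiffOn ℝ (⊤ : ℕ∞) (fun y => η y * η y * gradSq u y) U := (hη.mul hη).mul hw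
  change η x * η x * gradSq u x ≤ _
  rcases (gradSq_nonneg u x).eq_or_lt with hw0 | hwpos
  · rw [← hw0, mul_zero]; positivity
  have hηpos : 0 < η x := by
    have := norm_nonneg (x - z)
    simp only [hηdef]
    nlinarith
  have hηle : η x ≤ ρ ^ 2 := by simp only [hηdef]; nlinarith [sq_nonneg ‖x - z‖]
  have hcrit (i : Fin n) :
      η x * partialDeriv i (gradSq u) x = -2 * gradSq u x * partialDeriv i η x := by
    have h1 := (partialDeriv_partialDeriv_sq_mul hU hη hw hx i).1
    rw [partialDeriv_eq_zero_of_isLocalMax hmax i] at h1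
    refine mul_left_cancel₀ hηpos.ne' ?_
    linarith
  have hη2 (i : Fin n) : partialDeriv i (partialDeriv i η) x = -2 :=
    partialDeriv_partialDeriv_const_sub_norm_sq ρ z x i
  have hA : ∑ i, partialDeriv i η x ^ 2 = 4 * ‖x - z‖ ^ 2 := by
    rw [EuclideanSpace.norm_sq_eq, Finset.mul_sum]
    refine Finset.sum_congr rfl fun i _ => ?_
    rw [hηdef, partialDeriv_const_sub_norm_sq]
    simp
    ring
  have hlap : -6 * gradSq u x * ∑ i, partialDeriv i η x ^ 2 - 4 * n * η x * gradSq u x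
      + η x ^ 2 * laplacian (gradSq u) x ≤ 0 := by
    have hle : ∑ i, (-6 * gradSq u x * partialDeriv i η x ^ 2 - 4 * η x * gradSq u x
        + η x ^ 2 * partialDeriv i (partialDeriv i (gradSq u)) x) ≤ 0 := by
      refine Finset.sum_nonpos fun i _ => ?_
      have h2 := (partialDeriv_partialDeriv_sq_mul hU hη hw hx i).2
      have h3 := partialDeriv_partialDeriv_nonpos_of_isLocalMax hmax hG hU hx i
      rw [h2, hη2] at h3
      linear_combination h3 - 4 * partialDeriv i η x * hcrit i
    rw [Finset.sum_add_distrib, Finset.sum_sub_distrib, ← Finset.mul_sum, ← Finset.mul_sum] at hle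
    simp only [Finset.sum_const, Finset.card_univ, Fintype.card_fin, nsmul_eq_mul] at hle
    rw [← Finset.mul_sum] at hle
    rw [laplacian_eq_sum_partialDeriv]
    linarith
  have hboch := le_laplacian_gradSq hn hu hU hc heq hx
  set w := gradSq u x with hwdef
  set Q := ∑ i, partialDeriv i u x * partialDeriv i η x with hQ
  have hP : η x * ∑ i, partialDeriv i u x * partialDeriv i (gradSq u) x = -2 * w * Q := by
    rw [hQ, Finset.mul_sum, Finset.mul_sum]
    refine Finset.sum_congr rfl fun i _ => ?_
    linear_combination partialDeriv i u x * hcrit i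
  have hQle : Q ^ 2 ≤ w * (4 * ‖x - z‖ ^ 2) := by
    rw [← hA, hwdef, gradSq]
    simpa [sq] using Finset.sum_mul_sq_le_sq_mul_sq Finset.univ
      (fun i => partialDeriv i u x) (fun i => partialDeriv i η x)
  have hd : ‖x - z‖ ^ 2 ≤ ρ ^ 2 := by gcongr
  have hQabs : |Q| ≤ 2 * ρ * √w := by
    refine abs_le_of_sq_le_sq (hQle.trans ?_) (by positivity)
    rw [mul_pow, Real.sq_sqrt hwpos.le]
    nlinarith
  have hmain : 2 * (η x ^ 2 * w) / n + 4 * η x * Q - 24 * ρ ^ 2 - 4 * n * ρ ^ 2 ≤ 0 := by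
    have h4 : w * (2 * (η x ^ 2 * w) / n + 4 * η x * Q - 24 * ‖x - z‖ ^ 2 - 4 * n * η x) ≤ 0 := by
      have h5 := mul_le_mul_of_nonneg_left hboch (sq_nonneg (η x))
      rw [hA] at hlap
      have h6 : η x ^ 2 * (2 * w ^ 2 / n
          - 2 * ∑ i, partialDeriv i u x * partialDeriv i (gradSq u) x)
          = w * (2 * (η x ^ 2 * w) / n) + 4 * η x * w * Q := by
        linear_combination (-2 * η x) * hP
      linarith
    have h7 := nonpos_of_mul_nonpos_right h4 hwpos
    have h8 : n * η x ≤ n * ρ ^ 2 := by gcongr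
    linarith
  have hs2 : η x ^ 2 * w = (η x * √w) ^ 2 := by rw [mul_pow, Real.sq_sqrt hwpos.le]
  have hs0 : 0 ≤ η x * √w := by positivity
  have hηQ : -(2 * ρ * (η x * √w)) ≤ η x * Q := by
    nlinarith [neg_abs_le Q]
  rw [← sq, hs2]
  rw [hs2] at hmain
  generalize η x * √w = s at *
  refine pow_le_pow_left₀ hs0 ?_ 2
  by_contra! hlt
  have h9 : 20 * ρ * s ≤ 2 * s ^ 2 / n := by
    rw [le_div_iff₀ hn0]
    nlinarith
  have h10 : n * ρ ^ 2 ≥ ρ ^ 2 := by nlinarith [sq_nonneg ρ]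
  have h11 : 10 * n * ρ * ρ < s * ρ := by gcongr
  nlinarith [sq_pos_of_pos hρ]

/-- The interior gradient estimate for solutions of `Δu = -c - |∇u|²` with `c ≥ 0`. -/
theorem cutoff_sq_mul_gradSq_le {u : EuclideanSpace ℝ (Fin n) → ℝ} (hn : 1 ≤ n)
    (hu : ContDiffOn ℝ (⊤ : ℕ∞) u U) (hU : IsOpen U) {c : ℝ} (hc : 0 ≤ c)
    (heq : ∀ x ∈ U, laplacian u x = -c - gradSq u x) {z x : EuclideanSpace ℝ (Fin n)}
    {ρ : ℝ} (hρ : 0 < ρ) (hball : Metric.closedBall z ρ ⊆ U) (hx : x ∈ Metric.closedBall z ρ) :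
    (ρ ^ 2 - ‖x - z‖ ^ 2) * (ρ ^ 2 - ‖x - z‖ ^ 2) * gradSq u x ≤ (10 * n * ρ) ^ 2 := by
  set G : EuclideanSpace ℝ (Fin n) → ℝ :=
    fun y => (ρ ^ 2 - ‖y - z‖ ^ 2) * (ρ ^ 2 - ‖y - z‖ ^ 2) * gradSq u y with hG
  have hcont : ContinuousOn G (Metric.closedBall z ρ) :=
    ContinuousOn.mul (by fun_prop) ((hu.gradSq hU).continuousOn.mono hball)
  obtain ⟨y, hy, hmax⟩ := (isCompact_closedBall z ρ).exists_isMaxOn ⟨x, hx⟩ hcont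
  refine (hmax hx : G x ≤ G y).trans ?_
  rcases (mem_closedBall_iff_norm.1 hy).eq_or_lt with h | h
  · simp only [hG, h]
    rw [sub_self, zero_mul, zero_mul]
    positivity
  · refine cutoff_sq_mul_gradSq_le_of_isLocalMax hn hu hU hc heq (hball hy) hρ h ?_
    exact hmax.isLocalMax (Filter.mem_of_superset
      (Metric.isOpen_ball.mem_nhds (mem_ball_iff_norm.2 h)) Metric.ball_subset_closedBall)

theorem abs_sub_le_of_laplacian_eq {u : EuclideanSpace ℝ (Fin n) → ℝ} (hn : 1 ≤ n)
    (hu : ContDiffOn ℝ (⊤ : ℕ∞) u U) (hU : IsOpen U) {c : ℝ} (hc : 0 ≤ c)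
    (heq : ∀ x ∈ U, laplacian u x = -c - gradSq u x) {z x y : EuclideanSpace ℝ (Fin n)}
    {r : ℝ} (hr : 0 < r) (hball : Metric.ball z r ⊆ U) (hx : x ∈ Metric.ball z (r / 2))
    (hy : y ∈ Metric.ball z (r / 2)) : u x - u y ≤ 24 * n := by
  have hgrad (p) (hp : p ∈ Metric.ball z (r / 2)) : ‖fderiv ℝ u p‖ ≤ 24 * n / r := by
    have hpr := mem_ball_iff_norm.1 hp
    have h1 := cutoff_sq_mul_gradSq_le hn hu hU hc heq (z := z) (x := p) (ρ := 3 / 4 * r)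
      (by positivity) ((Metric.closedBall_subset_ball (by linarith)).trans hball)
      (mem_closedBall_iff_norm.2 (by linarith))
    have h2 : 5 / 16 * r ^ 2 ≤ (3 / 4 * r) ^ 2 - ‖p - z‖ ^ 2 := by
      nlinarith [norm_nonneg (p - z)]
    have h3 : 5 / 16 * r ^ 2 * (5 / 16 * r ^ 2) * gradSq u p ≤ (10 * n * (3 / 4 * r)) ^ 2 := by
      refine le_trans ?_ h1
      have := gradSq_nonneg u p
      have : 0 ≤ (3 / 4 * r) ^ 2 - ‖p - z‖ ^ 2 := le_trans (by positivity) h2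
      gcongr
    refine norm_fderiv_le_sqrt_sum_partialDeriv_sq.trans (Real.sqrt_le_iff.2 ⟨by positivity, ?_⟩)
    have h4 : ∑ i, partialDeriv i u p ^ 2 = gradSq u p := by simp [gradSq, sq]
    rw [h4, div_pow, le_div_iff₀ (by positivity)]
    refine le_of_mul_le_mul_left ?_ (by positivity : 0 < 25 / 256 * r ^ 2)
    linarith
  have hsub : Metric.ball z (r / 2) ⊆ U := (Metric.ball_subset_ball (by linarith)).trans hball
  have hlip := (convex_ball z (r / 2)).norm_image_sub_le_of_norm_fderiv_le
    (fun p hp => hu.differentiableAt_of_isOpen hU (hsub hp)) hgrad hy hx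
  have hxy : ‖x - y‖ ≤ r := by
    rw [← dist_eq_norm]
    have := dist_triangle_right x y z
    rw [Metric.mem_ball] at hx hy
    linarith
  calc u x - u y ≤ ‖u x - u y‖ := le_abs_self _
    _ ≤ 24 * n / r * ‖x - y‖ := hlip
    _ ≤ 24 * n / r * r := by gcongr
    _ = 24 * n := by field_simp

theorem laplacian_log {φ : EuclideanSpace ℝ (Fin n) → ℝ} (hφ : ContDiffOn ℝ (⊤ : ℕ∞) φ U)
    (hU : IsOpen U) (hpos : ∀ x ∈ U, 0 < φ x) {x : EuclideanSpace ℝ (Fin n)} (hx : x ∈ U) :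
    laplacian (fun y => Real.log (φ y)) x
      = laplacian φ x / φ x - gradSq (fun y => Real.log (φ y)) x := by
  have hu : ContDiffOn ℝ (⊤ : ℕ∞) (fun y => Real.log (φ y)) U :=
    hφ.log fun y hy => (hpos y hy).ne'
  have hfst (i : Fin n) : Set.EqOn (partialDeriv i φ)
      (fun y => φ y * partialDeriv i (fun y => Real.log (φ y)) y) U := fun y hy => by
    have h0 := (hpos y hy).ne'
    simp only [partialDeriv, fderiv.log (hφ.differentiableAt_of_isOpen hU hy) h0]
    simp [h0]
  have hx0 := (hpos x hx).ne'
  rw [eq_sub_iff_add_eq, eq_div_iff hx0, laplacian_eq_sum_partialDeriv,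
    laplacian_eq_sum_partialDeriv, gradSq, ← Finset.sum_add_distrib, Finset.sum_mul]
  refine Finset.sum_congr rfl fun i _ => ?_
  rw [partialDeriv_congr hU (hfst i) i hx,
    partialDeriv_mul (hφ.differentiableAt_of_isOpen hU hx)
      ((hu.partialDeriv hU i).differentiableAt_of_isOpen hU hx), hfst i hx]
  ring

theorem dirichletEigenvalue_nonneg (n : ℕ) (U : Set (EuclideanSpace ℝ (Fin n))) :
    0 ≤ dirichletEigenvalue n U := by
  refine Real.sInf_nonneg ?_
  rintro R ⟨f, -, -, -, -, rfl⟩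
  exact div_nonneg (integral_nonneg fun _ => by positivity) (integral_nonneg fun _ => by positivity)

end Harnack

theorem stmt_6 (n : ℕ) (hn : 1 ≤ n) (K : ℝ) (hK : 0 < K) :
    ∃ C ≥ (1 : ℝ), ∀ U : Set (EuclideanSpace ℝ (Fin n)), U.Nonempty → IsOpen U →
      Bornology.IsBounded U →
      ∀ φ : EuclideanSpace ℝ (Fin n) → ℝ, IsPrincipalDirichletEigenfunction U φ →
        ∀ (z : EuclideanSpace ℝ (Fin n)) (r : ℝ), 0 < r → Metric.ball z r ⊆ U →
          dirichletEigenvalue n U * r ^ 2 ≤ K →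
          ∀ x ∈ Metric.ball z (r / 2), ∀ y ∈ Metric.ball z (r / 2), φ x ≤ C * φ y := by
  have hC : (1 : ℝ) ≤ Real.exp (24 * n) := Real.one_le_exp (by positivity)
  refine ⟨Real.exp (24 * n), hC, ?_⟩
  intro U _ hU _ φ hφ z r hr hball _ x hx y hy
  have hsub : Metric.ball z (r / 2) ⊆ U := (Metric.ball_subset_ball (by linarith)).trans hball
  have hu : ContDiffOn ℝ (⊤ : ℕ∞) (fun p => Real.log (φ p)) U :=
    hφ.smooth.log fun p hp => (hφ.pos p hp).ne'
  have heq (p) (hp : p ∈ U) : laplacian (fun p => Real.log (φ p)) p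
      = -dirichletEigenvalue n U - gradSq (fun p => Real.log (φ p)) p := by
    rw [laplacian_log hφ.smooth hU hφ.pos hp, hφ.eigenEq p hp,
      mul_div_cancel_right₀ _ (hφ.pos p hp).ne']
  have hle := abs_sub_le_of_laplacian_eq hn hu hU (dirichletEigenvalue_nonneg n U) heq hr hball
    hx hy
  have hφx := hφ.pos x (hsub hx)
  have hφy := hφ.pos y (hsub hy)
  rw [← Real.log_le_log_iff hφx (by positivity), Real.log_mul (by positivity) hφy.ne',
    Real.log_exp]
  linarith
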